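/- arXiv:2508.09607 — 3 statements merged into one kernel-verified Lean document; each statement's English description precedes it below -/
import Mathlib

section
/- Let 𝔥 be a finite-dimensional semisimple Lie algebra over a field k of characteristic zero with a ℤ/mℤ-grading 𝔥 = ⊕ 𝔥_i. For x ∈ 𝔥_{-1} and any n ∈ ℤ/mℤ, one has dim 𝔥_n − dim 𝔷_{𝔥_n}(x) = dim 𝔥_{1−n} − dim 𝔷_{𝔥_{1−n}}(x), where 𝔷_{𝔥_n}(x) = {y ∈ 𝔥_n : [x,y] = 0}. -/
open Module in
theorem rank_flip_aux {k V W : Type*} [Field k] [AddCommGroup V] [Module k V] [AddCommGroup W]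
    [Module k W] [FiniteDimensional k V] [FiniteDimensional k W] (B : V →ₗ[k] W →ₗ[k] k) :
    finrank k (LinearMap.range B) = finrank k (LinearMap.range B.flip) := by
  have h : B.flip = (LinearMap.dualMap B).comp (evalEquiv k W).toLinearMap := by
    ext w v
    simp
  rw [h, LinearMap.range_comp_of_range_eq_top _ (LinearEquiv.range _)]
  exact (LinearMap.finrank_range_dualMap_eq_finrank_range B).symm

theorem killing_graded_aux {k L : Type*} [Field k] [LieRing L] [LieAlgebra k L]
    [FiniteDimensional k L]
    (m : ℕ) (𝔥 : ZMod m → Submodule k L)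
    (hdecomp : DirectSum.IsInternal 𝔥)
    (hbracket : ∀ (i j : ZMod m), ∀ x ∈ 𝔥 i, ∀ y ∈ 𝔥 j, ⁅x, y⁆ ∈ 𝔥 (i + j))
    (i j : ZMod m) (hij : i + j ≠ 0) (y z : L) (hy : y ∈ 𝔥 i) (hz : z ∈ 𝔥 j) :
    killingForm k L y z = 0 := by
  rw [killingForm_apply_apply]
  refine LinearMap.trace_eq_zero_of_mapsTo_ne hdecomp (fun l => i + (j + l)) ?_ ?_
  · intro l h
    apply hij
    rw [← add_assoc] at h
    simpa using h
  · intro l w hw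
    exact hbracket _ _ _ hy _ (hbracket _ _ _ hz _ hw)

theorem zero_of_killing_aux {k L : Type*} [Field k] [CharZero k] [LieRing L] [LieAlgebra k L]
    [FiniteDimensional k L] [LieAlgebra.IsSemisimple k L]
    (m : ℕ) (𝔥 : ZMod m → Submodule k L)
    (hdecomp : DirectSum.IsInternal 𝔥)
    (hbracket : ∀ (i j : ZMod m), ∀ x ∈ 𝔥 i, ∀ y ∈ 𝔥 j, ⁅x, y⁆ ∈ 𝔥 (i + j))
    (i j : ZMod m) (hij : i + j = 0) (y : L) (hy : y ∈ 𝔥 i)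
    (h : ∀ z ∈ 𝔥 j, killingForm k L y z = 0) : y = 0 := by
  have h1 : y ∈ LinearMap.ker (killingForm k L) := by
    rw [LinearMap.mem_ker]
    have : (⊤ : Submodule k L) ≤ LinearMap.ker (killingForm k L y) := by
      rw [← hdecomp.submodule_iSup_eq_top]
      refine iSup_le fun l z hz => ?_
      rw [LinearMap.mem_ker]
      by_cases hl : l = j
      · subst hl; exact h z hz
      · refine killing_graded_aux m 𝔥 hdecomp hbracket i l ?_ y z hy hz
        intro h'
        exact hl (add_left_cancel (h'.trans hij.symm))
    ext z
    exact this (Submodule.mem_top (x := z))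
  rwa [LieAlgebra.IsKilling.ker_killingForm_eq_bot, Submodule.mem_bot] at h1

/-- dimension identity for centralizers in a graded semisimple Lie algebra:
for `x ∈ 𝔥₋₁`, `dim 𝔥ₙ − dim 𝔷_{𝔥ₙ}(x) = dim 𝔥_{1−n} − dim 𝔷_{𝔥_{1−n}}(x)`. -/
theorem stmt2 {k L : Type*} [Field k] [CharZero k] [LieRing L] [LieAlgebra k L]
    [FiniteDimensional k L] [LieAlgebra.IsSemisimple k L]
    (m : ℕ) (𝔥 : ZMod m → Submodule k L)
    (hdecomp : DirectSum.IsInternal 𝔥)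
    (hbracket : ∀ (i j : ZMod m), ∀ x ∈ 𝔥 i, ∀ y ∈ 𝔥 j, ⁅x, y⁆ ∈ 𝔥 (i + j))
    (x : L) (hx : x ∈ 𝔥 (-1)) (n : ZMod m) :
    Module.finrank k ↥(𝔥 n) -
        Module.finrank k ↥(𝔥 n ⊓ LinearMap.ker (LieAlgebra.ad k L x)) =
      Module.finrank k ↥(𝔥 (1 - n)) -
        Module.finrank k ↥(𝔥 (1 - n) ⊓ LinearMap.ker (LieAlgebra.ad k L x)) := by
  let B : 𝔥 n →ₗ[k] 𝔥 (1 - n) →ₗ[k] k :=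
    LinearMap.compl₁₂ (killingForm k L) ((LieAlgebra.ad k L x).comp (𝔥 n).subtype) (𝔥 (1 - n)).subtype
  have hB : ∀ y z, B y z = killingForm k L ⁅x, (y : L)⁆ z := fun y z => rfl
  have hB' : ∀ y z, B y z = - killingForm k L ⁅x, (z : L)⁆ y := by
    intro y z
    rw [hB, LieModule.traceForm_apply_lie_apply', LieModule.traceForm_comm]
  have k1 : LinearMap.ker B = (LinearMap.ker (LieAlgebra.ad k L x)).comap (𝔥 n).subtype := by
    ext y
    simp only [LinearMap.mem_ker, Submodule.mem_comap, Submodule.subtype_apply,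
      LieAlgebra.ad_apply]
    constructor
    · intro h
      refine zero_of_killing_aux m 𝔥 hdecomp hbracket (-1 + n) (1 - n) (by ring) _
        (hbracket _ _ _ hx _ y.2) fun z hz => ?_
      rw [← hB y ⟨z, hz⟩, h]; rfl
    · intro h
      ext z
      rw [hB, h]; simp
  have k2 : LinearMap.ker B.flip =
      (LinearMap.ker (LieAlgebra.ad k L x)).comap (𝔥 (1 - n)).subtype := by
    ext z
    simp only [LinearMap.mem_ker, Submodule.mem_comap, Submodule.subtype_apply,
      LieAlgebra.ad_apply]
    constructor
    · intro h
      refine zero_of_killing_aux m 𝔥 hdecomp hbracket (-1 + (1 - n)) n (by ring) _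
        (hbracket _ _ _ hx _ z.2) fun y hy => ?_
      rw [← neg_eq_zero, ← hB' ⟨y, hy⟩ z, ← LinearMap.flip_apply, h]; rfl
    · intro h
      ext y
      rw [LinearMap.flip_apply, hB', h]; simp
  have r := rank_flip_aux B
  have e1 := LinearMap.finrank_range_add_finrank_ker B
  have e2 := LinearMap.finrank_range_add_finrank_ker B.flip
  rw [k1, ← Submodule.finrank_map_subtype_eq, Submodule.map_comap_subtype] at e1
  rw [k2, ← Submodule.finrank_map_subtype_eq, Submodule.map_comap_subtype] at e2
  omega
end

section
/- Let 𝔥 be a finite-dimensional semisimple Lie algebra over a field k of characteristic zero with a ℤ/mℤ-grading, and let (e,h,f) be an sl₂-triple with e ∈ 𝔥_1, h ∈ 𝔥_0, f ∈ 𝔥_{−1}. Assume 𝔥 = [𝔥,e] ⊕ 𝔷_𝔥(f). Then dim 𝔷_{𝔥_0}(e) = dim 𝔷_{𝔥_0}(f). -/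
theorem aux_proj {k L ι : Type*} [Field k] [AddCommGroup L] [Module k L] [DecidableEq ι]
    (A : ι → Submodule k L) (hd : DirectSum.IsInternal A) :
    ∃ p : ι → L →ₗ[k] L, (∀ i x, p i x ∈ A i) ∧ (∀ i, ∀ x ∈ A i, p i x = x) ∧
      (∀ i j, j ≠ i → ∀ x ∈ A j, p i x = 0) := by
  classical
  letI := hd.chooseDecomposition
  refine ⟨fun i => (A i).subtype ∘ₗ DirectSum.component k ι (fun i => A i) i ∘ₗ
    (DirectSum.decomposeLinearEquiv A).toLinearMap, ?_, ?_, ?_⟩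
  · intro i x
    simp
  · intro i x hx
    exact DirectSum.decompose_of_mem_same A hx
  · intro i j hij x hx
    exact DirectSum.decompose_of_mem_ne A hx hij

theorem aux_ind {k L ι : Type*} [Field k] [AddCommGroup L] [Module k L] [DecidableEq ι]
    (A : ι → Submodule k L) (hd : DirectSum.IsInternal A) {M : Type*} [AddCommGroup M] [Module k M]
    (g g' : L →ₗ[k] M) (h : ∀ i, ∀ x ∈ A i, g x = g' x) : g = g' := by
  ext x
  have hx : x ∈ ⨆ i, A i := by rw [hd.submodule_iSup_eq_top]; trivial
  induction hx using Submodule.iSup_induction' with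
  | mem i x hx => exact h i x hx
  | zero => simp
  | add x y _ _ h1 h2 => simp [h1, h2]

theorem aux_trace {k L : Type*} [Field k] [LieRing L] [LieAlgebra k L]
    [FiniteDimensional k L]
    (m : ℕ) (A : ZMod m → Submodule k L)
    (hd : DirectSum.IsInternal A)
    (hb : ∀ (i j : ZMod m), ∀ x ∈ A i, ∀ y ∈ A j, ⁅x, y⁆ ∈ A (i + j))
    (j : ZMod m) (hj : j ≠ 0) (x y : L) (hx : x ∈ A 0) (hy : y ∈ A j) :
    killingForm k L x y = 0 := by
  rw [killingForm_apply_apply]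
  refine LinearMap.trace_eq_zero_of_mapsTo_ne hd (fun i => j + i) (by simpa using hj) ?_
  intro i z hz
  have := hb 0 (j + i) x hx _ (hb j i y hy z hz)
  simpa using this

/-- For a normal `sl₂`-triple `(e, H, f)` in a graded finite-dimensional
semisimple Lie algebra with `𝔥 = [𝔥,e] ⊕ 𝔷_𝔥(f)`, one has
`dim 𝔷_{𝔥₀}(e) = dim 𝔷_{𝔥₀}(f)`. -/
theorem stmt4 {k L : Type*} [Field k] [CharZero k] [LieRing L] [LieAlgebra k L]
    [FiniteDimensional k L] [LieAlgebra.IsSemisimple k L]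
    (m : ℕ) (𝔥 : ZMod m → Submodule k L)
    (hdecomp : DirectSum.IsInternal 𝔥)
    (hbracket : ∀ (i j : ZMod m), ∀ x ∈ 𝔥 i, ∀ y ∈ 𝔥 j, ⁅x, y⁆ ∈ 𝔥 (i + j))
    (e H f : L)
    (hene : e ≠ 0) (hHne : H ≠ 0) (hfne : f ≠ 0)
    (he1 : e ∈ 𝔥 1) (hH0 : H ∈ 𝔥 0) (hfm1 : f ∈ 𝔥 (-1))
    (t1 : ⁅H, e⁆ = (2 : k) • e) (t2 : ⁅H, f⁆ = (-2 : k) • f) (t3 : ⁅e, f⁆ = H)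
    (hsup : LinearMap.range (LieAlgebra.ad k L e) ⊔ LinearMap.ker (LieAlgebra.ad k L f) = ⊤)
    (hinf : LinearMap.range (LieAlgebra.ad k L e) ⊓ LinearMap.ker (LieAlgebra.ad k L f) = ⊥) :
    Module.finrank k ↥(𝔥 0 ⊓ LinearMap.ker (LieAlgebra.ad k L e)) =
      Module.finrank k ↥(𝔥 0 ⊓ LinearMap.ker (LieAlgebra.ad k L f)) := by
  classical
  obtain ⟨p, p1, p2, p3⟩ := aux_proj 𝔥 hdecomp
  have comm : ∀ i j : ZMod m, ∀ a ∈ 𝔥 i, ∀ y, p (i + j) ⁅a, y⁆ = ⁅a, p j y⁆ := by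
    intro i j a ha y
    have := aux_ind 𝔥 hdecomp (p (i + j) ∘ₗ (LieAlgebra.ad k L a : L →ₗ[k] L))
      ((LieAlgebra.ad k L a : L →ₗ[k] L) ∘ₗ p j) (by
        intro l x hx
        have h1 := hbracket i l a ha x hx
        by_cases hl : l = j
        · subst hl
          simp [p2 _ _ hx, p2 _ _ h1]
        · simp [p3 _ _ hl _ hx, p3 (i + j) (i + l) (by simpa using hl) _ h1])
    simpa using LinearMap.congr_fun this y
  have hk : ∀ x ∈ 𝔥 0, ∀ y, killingForm k L x y = killingForm k L x (p 0 y) := by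
    intro x hx y
    have := aux_ind 𝔥 hdecomp (killingForm k L x) (killingForm k L x ∘ₗ p 0) (by
        intro l y hy
        by_cases hl : l = 0
        · subst hl
          simp [p2 _ _ hy]
        · simp only [LinearMap.comp_apply, p3 _ _ hl _ hy, map_zero]
          exact aux_trace m 𝔥 hdecomp hbracket l hl x y hx hy)
    simpa using LinearMap.congr_fun this y
  have hsymm : ∀ x y, killingForm k L x y = killingForm k L y x :=
    fun x y => LieModule.traceForm_comm k L L x y
  have hnd := LieAlgebra.IsKilling.killingForm_nondegenerate k L
  have hinv : ∀ x y, killingForm k L ⁅e, y⁆ x = - killingForm k L y ⁅e, x⁆ := by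
    intro x y
    rw [← lie_skew, map_neg, LinearMap.neg_apply]
    exact congrArg _ (LieModule.traceForm_apply_lie_apply k L L y e x)
  have hnd0 : ∀ x, (∀ y, killingForm k L y x = 0) → x = 0 := hnd.2
  have hp0 : ∀ y, p 0 ⁅e, y⁆ = ⁅e, p (-1) y⁆ := fun y => by
    have := comm 1 (-1) e he1 y
    rwa [add_neg_cancel] at this
  have hpf : ∀ y, p (-1) ⁅f, y⁆ = ⁅f, p 0 y⁆ := fun y => by
    have := comm (-1) 0 f hfm1 y
    rwa [add_zero] at this
  have hpp : ∀ x, p 0 (p 0 x) = p 0 x := fun x => p2 _ _ (p1 _ _)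
  set U : Submodule k L := LinearMap.range (LieAlgebra.ad k L e : L →ₗ[k] L) ⊔ LinearMap.ker (p 0) with hU
  have horth : (killingForm k L).orthogonal U =
      𝔥 0 ⊓ LinearMap.ker (LieAlgebra.ad k L e : L →ₗ[k] L) := by
    ext x
    rw [LinearMap.BilinForm.mem_orthogonal_iff, Submodule.mem_inf, LinearMap.mem_ker]
    constructor
    · intro h
      refine ⟨?_, ?_⟩
      · have : x - p 0 x = 0 := by
          apply hnd0
          intro y
          have e1 : killingForm k L (y - p 0 y) x = 0 :=
            h _ (Submodule.mem_sup_right (by simp [hpp]))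
          have e2 := hk (p 0 y) (p1 _ _) x
          have e3 := hk (p 0 x) (p1 _ _) y
          rw [hsymm, hsymm (p 0 x)] at e3
          simp only [map_sub, LinearMap.sub_apply] at e1 ⊢
          linear_combination e1 + e2 - e3
        rw [sub_eq_zero] at this
        rw [this]
        exact p1 _ _
      · apply hnd0
        intro y
        have := h ⁅e, y⁆ (Submodule.mem_sup_left ⟨y, rfl⟩)
        have h2 := hinv x y
        change killingForm k L ⁅e, y⁆ x = 0 at this
        rw [this] at h2
        simpa using h2.symm
    · rintro ⟨h0, h1⟩ u hu
      obtain ⟨_, ⟨y, rfl⟩, c, hc, rfl⟩ := Submodule.mem_sup.1 hu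
      change killingForm k L (⁅e, y⁆ + c) x = 0
      change ⁅e, x⁆ = 0 at h1
      rw [LinearMap.mem_ker] at hc
      rw [map_add, LinearMap.add_apply, hinv, h1, hsymm c, hk x h0 c, hc]
      simp
  have hcompl : IsCompl U (𝔥 0 ⊓ LinearMap.ker (LieAlgebra.ad k L f : L →ₗ[k] L)) := by
    constructor
    · rw [Submodule.disjoint_def]
      rintro x hx ⟨hx0, hxf⟩
      obtain ⟨_, ⟨y, rfl⟩, c, hc, rfl⟩ := Submodule.mem_sup.1 hx
      rw [LinearMap.mem_ker] at hc
      have h3 := p2 _ _ hx0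
      rw [map_add, hc, add_zero, LieAlgebra.ad_apply, hp0] at h3
      rw [← Submodule.mem_bot k, ← hinf, Submodule.mem_inf]
      exact ⟨⟨p (-1) y, h3⟩, hxf⟩
    · rw [codisjoint_iff, eq_top_iff]
      rintro x -
      have hx : x ∈ LinearMap.range (LieAlgebra.ad k L e) ⊔ LinearMap.ker (LieAlgebra.ad k L f) := by
        rw [hsup]; trivial
      obtain ⟨_, ⟨y, rfl⟩, c, hc, rfl⟩ := Submodule.mem_sup.1 hx
      refine add_mem (Submodule.mem_sup_left (Submodule.mem_sup_left ⟨y, rfl⟩)) ?_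
      rw [← sub_add_cancel c (p 0 c)]
      refine add_mem (Submodule.mem_sup_left (Submodule.mem_sup_right ?_))
        (Submodule.mem_sup_right ⟨p1 _ _, ?_⟩)
      · simp [hpp]
      · change ⁅f, c⁆ = 0 at hc
        change ⁅f, p 0 c⁆ = 0
        rw [← hpf, hc, map_zero]
  have f1 := LinearMap.BilinForm.finrank_orthogonal hnd U
  have f2 := Submodule.finrank_add_eq_of_isCompl hcompl
  rw [horth] at f1
  rw [f1]
  omega
end

section
/- Let V and W be finite-dimensional vector spaces over an algebraically closed field k of characteristic zero, each equipped with a linear Gₘ-action with all weights positive, and suppose f : V → W is a Gₘ-equivariant polynomial morphism such that the (graded) weights of V and W coincide with multiplicity and f⁻¹(0) = {0}. Then f is an isomorphism of varieties. -/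
open MvPolynomial in
/-- Fewer than `n` polynomials in `n` variables cannot have the origin as only common zero. -/
theorem slodowy_card_le {k : Type*} [Field k] [IsAlgClosed k] (n : ℕ)
    (S : Finset (MvPolynomial (Fin n) k)) (h0 : ∀ p ∈ S, eval 0 p = 0)
    (hS : ∀ v : Fin n → k, (∀ p ∈ S, eval v p = 0) → v = 0) : n ≤ S.card := by
  classical
  have key : ringKrullDim (MvPolynomial (Fin n) k) ≤ ((S.card : ℕ∞) : WithBot ℕ∞) := by
    rw [ringKrullDim_le_iff_isMaximal_height_le]
    intro M hM
    obtain ⟨a, ha⟩ := eq_vanishingIdeal_singleton_of_isMaximal k hM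
    let τ : MvPolynomial (Fin n) k →ₐ[k] MvPolynomial (Fin n) k :=
      aeval (fun i => X i - C (a i))
    have hτ : ∀ v p, eval v (τ p) = eval (v - a) p := by
      intro v p
      have : (aeval v : MvPolynomial (Fin n) k →ₐ[k] k).comp τ = aeval (v - a) := by
        ext i; simp [τ]
      have := DFunLike.congr_fun this p
      simpa [aeval_eq_eval] using this
    have hmin : M ∈ (Ideal.span ((S.image τ : Finset _) : Set (MvPolynomial (Fin n) k))).minimalPrimes := by
      refine ⟨⟨hM.isPrime, ?_⟩, ?_⟩
      · rw [Ideal.span_le]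
        intro q hq
        simp only [Finset.coe_image, Set.mem_image, Finset.mem_coe] at hq
        obtain ⟨p, hp, rfl⟩ := hq
        rw [ha, SetLike.mem_coe, mem_vanishingIdeal_singleton_iff]
        simp only [aeval_eq_eval, RingHom.coe_coe, hτ, sub_self]
        exact h0 p hp
      · rintro p ⟨hp, hle⟩ -
        rw [← IsPrime.vanishingIdeal_zeroLocus (K := k) p, ha]
        apply vanishingIdeal_anti_mono
        intro v hv
        have : v - a = 0 := by
          apply hS
          intro q hq
          rw [← hτ]
          have := hv (τ q) (hle (Ideal.subset_span (by
            simp only [Finset.coe_image]; exact ⟨q, hq, rfl⟩)))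
          simpa [aeval_eq_eval] using this
        exact sub_eq_zero.mp this
    have h1 := Ideal.height_le_card_of_mem_minimalPrimes_span_finset hmin
    have h2 : ((S.image τ).card : ℕ∞) ≤ S.card := by exact_mod_cast Finset.card_image_le
    exact WithBot.coe_le_coe.mpr (h1.trans h2)
  rw [MvPolynomial.ringKrullDim_of_isNoetherianRing, ringKrullDim_eq_zero_of_field] at key
  simp only [Nat.card_eq_fintype_card, Fintype.card_fin, zero_add] at key
  exact_mod_cast key

/-- A surjective endomorphism of a Noetherian ring is injective. -/
theorem slodowy_inj {R : Type*} [CommRing R] [IsNoetherianRing R] (φ : R →+* R)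
    (hφ : Function.Surjective φ) : Function.Injective φ := by
  let K : ℕ →o Ideal R := ⟨fun m => RingHom.ker (φ ^ m), by
    refine monotone_nat_of_le_succ fun m x hx => ?_
    rw [RingHom.mem_ker] at hx ⊢
    rw [pow_succ']
    change φ ((φ ^ m) x) = 0
    rw [hx, map_zero]⟩
  obtain ⟨N, hN⟩ := monotone_stabilizes_iff_noetherian.mpr (inferInstance : IsNoetherian R R) K
  rw [injective_iff_map_eq_zero]
  intro a ha
  have hs : Function.Surjective (φ ^ N : R →+* R) := by
    rw [RingHom.coe_pow]; exact hφ.iterate N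
  obtain ⟨b, rfl⟩ := hs a
  have hb : b ∈ K (N + 1) := by
    change b ∈ RingHom.ker (φ ^ (N + 1))
    rw [RingHom.mem_ker, pow_succ']
    simpa [RingHom.mul_def] using ha
  rw [← hN (N + 1) (Nat.le_succ N)] at hb
  exact hb

open MvPolynomial in
/-- Equivariance forces weighted homogeneity of the components. -/
theorem slodowy_homog {k : Type*} [Field k] [CharZero k] (n : ℕ) (d : Fin n → ℕ)
    (p : MvPolynomial (Fin n) k) (e : ℕ)
    (h : ∀ (t : k) (v : Fin n → k), eval (fun i => t ^ d i * v i) p = t ^ e * eval v p)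
    (m : Fin n →₀ ℕ) (hm : m ∈ p.support) : ∑ i, d i * m i = e := by
  classical
  let τ : MvPolynomial (Fin n) k →ₐ[k] MvPolynomial (Fin n) k :=
      aeval (fun i => C ((2 : k) ^ d i) * X i)
  have hτ : τ p = C ((2 : k) ^ e) * p := by
    apply MvPolynomial.funext
    intro v
    have : (aeval v : MvPolynomial (Fin n) k →ₐ[k] k).comp τ = aeval (fun i => 2 ^ d i * v i) := by
      ext i; simp [τ]
    have := DFunLike.congr_fun this p
    simp only [AlgHom.comp_apply, aeval_eq_eval, RingHom.coe_coe] at this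
    simp [this, h]
  have hmon : ∀ q : MvPolynomial (Fin n) k, coeff m (τ q) = 2 ^ (∑ i, d i * m i) * coeff m q := by
    intro q
    induction q using MvPolynomial.induction_on' with
    | monomial u a =>
      have : τ (monomial u a) = monomial u (2 ^ (∑ i, d i * u i) * a) := by
        rw [monomial_eq, monomial_eq, Finsupp.prod_fintype _ _ (by simp)]
        simp only [τ, map_mul, map_prod, map_pow, aeval_X, algHom_C, algebraMap_eq, mul_pow,
          Finset.prod_mul_distrib]
        rw [← Finset.prod_pow_eq_pow_sum]
        simp only [pow_mul, map_prod, map_pow]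
        ring
      rw [this, coeff_monomial, coeff_monomial]
      split_ifs with hu
      · rw [hu]
      · simp
    | add a b ha hb => simp [ha, hb, mul_add]
  have h1 := hmon p
  rw [hτ, coeff_C_mul] at h1
  have h2 := mul_right_cancel₀ (mem_support_iff.mp hm) h1
  have h3 : (2 : ℕ) ^ e = 2 ^ (∑ i, d i * m i) := by exact_mod_cast h2
  exact (Nat.pow_right_injective le_rfl h3).symm

open MvPolynomial in
/-- The linear part of weight `e`. -/
noncomputable def slodowyLin {k : Type*} [Field k] (n : ℕ) (d : Fin n → ℕ) (e : ℕ)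
    (p : MvPolynomial (Fin n) k) : MvPolynomial (Fin n) k :=
  ∑ i with d i = e, coeff (Finsupp.single i 1) p • X i

open MvPolynomial in
theorem slodowy_sub_mem {k : Type*} [Field k] (n : ℕ) (d : Fin n → ℕ) (hd : ∀ i, 0 < d i) (e : ℕ)
    (p : MvPolynomial (Fin n) k) (h : ∀ m ∈ p.support, ∑ i, d i * m i = e) :
    p - slodowyLin n d e p ∈ Algebra.adjoin k (X '' {i | d i < e}) := by
  classical
  rw [MvPolynomial.as_sum (p - slodowyLin n d e p)]
  refine Subalgebra.sum_mem _ fun m hm => ?_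
  rw [monomial_eq, ← algebraMap_eq]
  refine Subalgebra.mul_mem _ (Subalgebra.algebraMap_mem _ _) ?_
  refine Subalgebra.prod_mem _ fun i hi => Subalgebra.pow_mem _ (Algebra.subset_adjoin ?_) _
  refine ⟨i, ?_, rfl⟩
  by_contra hlt
  simp only [Set.mem_setOf_eq, not_lt] at hlt
  -- the coefficient of the linear part
  have hc : coeff m (slodowyLin n d e p) =
      ∑ j with d j = e, if Finsupp.single j 1 = m then coeff (Finsupp.single j 1) p else 0 := by
    simp [slodowyLin, coeff_sum, coeff_X', mul_ite]
  have hmi : 1 ≤ m i := Nat.one_le_iff_ne_zero.mpr (Finsupp.mem_support_iff.mp hi)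
  have hdi := hd i
  rw [mem_support_iff, coeff_sub, hc] at hm
  by_cases hp : m ∈ p.support
  · have hsum := h m hp
    rw [← Finset.add_sum_erase _ _ (Finset.mem_univ i)] at hsum
    have h1 : d i * 1 ≤ d i * m i := Nat.mul_le_mul_left _ hmi
    have h2 : d i * m i = d i * 1 := by omega
    have h3 : m i = 1 := Nat.eq_of_mul_eq_mul_left hdi h2
    have h4 : ∑ x ∈ Finset.univ.erase i, d x * m x = 0 := by omega
    have hie : d i = e := by rw [h3] at hsum; omega
    have hms : m = Finsupp.single i 1 := by
      ext j
      by_cases hj : j = i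
      · subst hj; simp [h3]
      · have := (Finset.sum_eq_zero_iff.mp h4) j (by simp [hj])
        have hdj := hd j
        rw [Finsupp.single_eq_of_ne hj]
        rcases Nat.mul_eq_zero.mp this with h | h
        · omega
        · exact h
    subst hms
    apply hm
    rw [Finset.sum_eq_single i]
    · simp
    · intro b _ hb
      rw [if_neg]
      intro hh
      exact hb ((Finsupp.single_left_inj one_ne_zero).mp hh)
    · intro hh; simp [hie] at hh
  · rw [notMem_support_iff] at hp
    apply hm
    rw [hp, Finset.sum_eq_zero, sub_zero]
    intro j _
    split_ifs with hj
    · rw [hj, hp]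
    · rfl

open MvPolynomial in
theorem slodowy_X_mem {k : Type*} [Field k] [IsAlgClosed k]
    (n : ℕ) (d : Fin n → ℕ) (hd : ∀ i, 0 < d i)
    (P : Fin n → MvPolynomial (Fin n) k)
    (hP : ∀ j, ∀ m ∈ (P j).support, ∑ i, d i * m i = d j)
    (hP0 : ∀ j, eval 0 (P j) = 0)
    (hfiber : ∀ v : Fin n → k, (∀ j, eval v (P j) = 0) → v = 0) :
    ∀ e i, d i = e → (X i : MvPolynomial (Fin n) k) ∈ Algebra.adjoin k (Set.range P) := by
  classical
  intro e
  induction e using Nat.strong_induction_on with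
  | _ e ih =>
  have hlow : Algebra.adjoin k (X '' {i | d i < e}) ≤ Algebra.adjoin k (Set.range P) := by
    rw [Algebra.adjoin_le_iff]
    rintro _ ⟨i, hi, rfl⟩
    exact ih (d i) hi i rfl
  let B : Finset (Fin n) := Finset.univ.filter (fun i => d i = e)
  let U : Submodule k (MvPolynomial (Fin n) k) := Submodule.span k (X '' (B : Set (Fin n)))
  let Ls : Set (MvPolynomial (Fin n) k) := (fun j => slodowyLin n d e (P j)) '' (B : Set (Fin n))
  have hLsfin : Ls.Finite := B.finite_toSet.image _
  have hLU : Submodule.span k Ls ≤ U := by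
    rw [Submodule.span_le]
    rintro _ ⟨j, -, rfl⟩
    refine Submodule.sum_mem _ fun i hi => Submodule.smul_mem _ _ (Submodule.subset_span ⟨i, ?_, rfl⟩)
    simpa [B] using hi
  have hUfin : FiniteDimensional k U :=
    FiniteDimensional.span_of_finite k (B.finite_toSet.image _)
  have hUrank : Module.finrank k U ≤ B.card := by
    have := finrank_span_finset_le_card (R := k) (B.image (X : Fin n → MvPolynomial (Fin n) k))
    rw [Finset.coe_image] at this
    exact this.trans Finset.card_image_le
  have hLfd : FiniteDimensional k (Submodule.span k Ls) := FiniteDimensional.span_of_finite k hLsfin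
  obtain ⟨T, hTs, hTcard, hTspan, -⟩ := Submodule.exists_finset_span_eq_linearIndepOn k Ls
  let lo : Finset (Fin n) := Finset.univ.filter (fun i => d i < e)
  let hi' : Finset (Fin n) := Finset.univ.filter (fun i => e < d i)
  have hcard : lo.card + B.card + hi'.card = n := by
    have h1 : Disjoint lo B := by
      rw [Finset.disjoint_left]; intro x; simp only [lo, B, Finset.mem_filter]; omega
    have h2 : Disjoint (lo ∪ B) hi' := by
      rw [Finset.disjoint_left]; intro x
      simp only [lo, B, hi', Finset.mem_filter, Finset.mem_union]; omega
    have h3 : (lo ∪ B) ∪ hi' = Finset.univ := by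
      ext x; simp only [lo, B, hi', Finset.mem_filter, Finset.mem_union, Finset.mem_univ]
      have := lt_trichotomy (d x) e
      tauto
    rw [← Finset.card_union_of_disjoint h1, ← Finset.card_union_of_disjoint h2, h3]
    simp
  have hlin0 : ∀ e' j, eval 0 (slodowyLin n d e' (P j)) = 0 := by
    intro e' j
    simp [slodowyLin, smul_eval]
  -- evaluation on the low subalgebra
  have hadj : ∀ v : Fin n → k, (∀ i, d i < e → v i = 0) →
      ∀ p ∈ Algebra.adjoin k (X '' {i | d i < e}), eval v p = eval 0 p := by
    intro v hv p hp
    have hle : Algebra.adjoin k (X '' {i | d i < e}) ≤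
        AlgHom.equalizer (aeval v : MvPolynomial (Fin n) k →ₐ[k] k) (aeval 0) := by
      rw [Algebra.adjoin_le_iff]
      rintro _ ⟨i, hi, rfl⟩
      simp [AlgHom.mem_equalizer, hv i hi]
    have := hle hp
    rw [AlgHom.mem_equalizer] at this
    simpa only [aeval_eq_eval, RingHom.coe_coe] using this
  have hge : n ≤ (lo.image X ∪ T ∪ hi'.image P).card := by
    apply slodowy_card_le
    · intro p hp
      simp only [Finset.mem_union, Finset.mem_image] at hp
      rcases hp with (⟨i, -, rfl⟩ | hp) | ⟨j, -, rfl⟩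
      · simp
      · obtain ⟨j, -, rfl⟩ := hTs hp
        exact hlin0 e j
      · exact hP0 j
    · intro v hv
      simp only [Finset.mem_union, Finset.mem_image] at hv
      have hvlo : ∀ i, d i < e → v i = 0 := by
        intro i hi
        have := hv (X i) (Or.inl (Or.inl ⟨i, by simp [lo, hi], rfl⟩))
        simpa using this
      have hvL : ∀ j ∈ B, eval v (slodowyLin n d e (P j)) = 0 := by
        intro j hj
        have h1 : slodowyLin n d e (P j) ∈ Submodule.span k (T : Set (MvPolynomial (Fin n) k)) := by
          rw [hTspan]; exact Submodule.subset_span ⟨j, hj, rfl⟩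
        have h2 : Submodule.span k (T : Set (MvPolynomial (Fin n) k)) ≤
            LinearMap.ker (aeval v : MvPolynomial (Fin n) k →ₐ[k] k).toLinearMap := by
          rw [Submodule.span_le]
          intro q hq
          have := hv q (Or.inl (Or.inr hq))
          simpa [aeval_eq_eval] using this
        have := h2 h1
        simpa [aeval_eq_eval] using this
      apply hfiber
      intro j
      have hsub := slodowy_sub_mem n d hd (d j) (P j) (hP j)
      rcases lt_trichotomy (d j) e with hj | hj | hj
      · have h1 : P j - slodowyLin n d (d j) (P j) ∈ Algebra.adjoin k (X '' {i | d i < e}) :=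
          Algebra.adjoin_mono (Set.image_mono fun i (hi : d i < d j) => hi.trans hj) hsub
        have h2 : slodowyLin n d (d j) (P j) ∈ Algebra.adjoin k (X '' {i | d i < e}) := by
          refine Subalgebra.sum_mem _ fun i hi => Subalgebra.smul_mem _ ?_ _
          refine Algebra.subset_adjoin ⟨i, ?_, rfl⟩
          simp only [Finset.mem_filter] at hi
          simp only [Set.mem_setOf_eq]
          omega
        have h3 := Subalgebra.add_mem _ h1 h2
        rw [sub_add_cancel] at h3
        rw [hadj v hvlo _ h3, hP0]
      · rw [hj] at hsub
        have h1 := hadj v hvlo _ hsub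
        rw [map_sub, map_sub, hvL j (by simp [B, hj]), hP0, hlin0, sub_zero, sub_zero] at h1
        exact h1
      · exact hv (P j) (Or.inr ⟨j, by simp [hi', hj], rfl⟩)
  have hTB : B.card ≤ T.card := by
    have h1 := Finset.card_union_le (lo.image X ∪ T) (hi'.image P)
    have h2 := Finset.card_union_le (lo.image (X : Fin n → MvPolynomial (Fin n) k)) T
    have h3 : (lo.image (X : Fin n → MvPolynomial (Fin n) k)).card ≤ lo.card :=
      Finset.card_image_le
    have h4 : (hi'.image P).card ≤ hi'.card := Finset.card_image_le
    omega
  have hEq : Submodule.span k Ls = U :=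
    Submodule.eq_of_le_of_finrank_le hLU (by omega)
  intro i hi
  have hiU : (X i : MvPolynomial (Fin n) k) ∈ Submodule.span k Ls := by
    rw [hEq]; exact Submodule.subset_span ⟨i, by simp [B, hi], rfl⟩
  have hle : Submodule.span k Ls ≤ Subalgebra.toSubmodule (Algebra.adjoin k (Set.range P)) := by
    rw [Submodule.span_le]
    rintro _ ⟨j, hj, rfl⟩
    have hje : d j = e := by simpa [B] using hj
    have hsub := slodowy_sub_mem n d hd (d j) (P j) (hP j)
    rw [hje] at hsub
    have h1 : P j ∈ Algebra.adjoin k (Set.range P) := Algebra.subset_adjoin ⟨j, rfl⟩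
    have h2 := Subalgebra.sub_mem _ h1 (hlow hsub)
    rw [sub_sub_cancel] at h2
    exact h2
  exact hle hiU

/-- Slodowy's lemma: a `𝔾ₘ`-equivariant polynomial morphism between spaces
with the same positive weights (with multiplicity) and zero-dimensional central fiber is an
isomorphism of varieties (i.e. bijective with polynomial inverse). Both spaces are modeled
as `Fin n → k` with `t` acting by `t ^ d i` in the `i`-th coordinate. -/
theorem stmt8 {k : Type*} [Field k] [IsAlgClosed k] [CharZero k]
    (n : ℕ) (d : Fin n → ℕ) (hd : ∀ i, 0 < d i)
    (P : Fin n → MvPolynomial (Fin n) k)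
    (f : (Fin n → k) → (Fin n → k))
    (hf : ∀ v, f v = fun j => MvPolynomial.eval v (P j))
    (hequiv : ∀ (t : k) (v : Fin n → k),
        f (fun i => t ^ d i * v i) = fun j => t ^ d j * f v j)
    (hfiber : ∀ v, f v = 0 → v = 0) :
    ∃ (Q : Fin n → MvPolynomial (Fin n) k) (g : (Fin n → k) → (Fin n → k)),
      (∀ u, g u = fun j => MvPolynomial.eval u (Q j)) ∧
      Function.LeftInverse g f ∧ Function.RightInverse g f := by
  classical
  have hev : ∀ (t : k) (v : Fin n → k) (j), MvPolynomial.eval (fun i => t ^ d i * v i) (P j)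
      = t ^ d j * MvPolynomial.eval v (P j) := by
    intro t v j
    have := congrFun (hequiv t v) j
    simpa [hf] using this
  have hP0 : ∀ j, MvPolynomial.eval 0 (P j) = 0 := by
    intro j
    have := hev 0 0 j
    rw [zero_pow (hd j).ne', zero_mul] at this
    rw [← this]
    congr 2
    funext i
    simp
  have hX := slodowy_X_mem n d hd P
    (fun j m hm => slodowy_homog n d (P j) (d j) (fun t v => hev t v j) m hm) hP0
    (fun v hv => hfiber v (by rw [hf]; funext j; exact hv j))
  have hQ : ∀ i, ∃ q : MvPolynomial (Fin n) k, MvPolynomial.aeval P q = MvPolynomial.X i := by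
    intro i
    have := hX (d i) i rfl
    rw [Algebra.adjoin_range_eq_range_aeval] at this
    exact this
  choose Q hQ using hQ
  have hPQ : (MvPolynomial.aeval P).comp (MvPolynomial.aeval Q) = AlgHom.id k (MvPolynomial (Fin n) k) := by
    apply MvPolynomial.algHom_ext
    intro i
    rw [AlgHom.comp_apply, MvPolynomial.aeval_X, hQ, AlgHom.id_apply]
  have hsurj : Function.Surjective (MvPolynomial.aeval P : MvPolynomial (Fin n) k →ₐ[k] _) :=
    fun p => ⟨MvPolynomial.aeval Q p, DFunLike.congr_fun hPQ p⟩
  have hinj := slodowy_inj (MvPolynomial.aeval P : MvPolynomial (Fin n) k →ₐ[k] _).toRingHom hsurj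
  have hQP : ∀ j, MvPolynomial.aeval Q (P j) = MvPolynomial.X j := by
    intro j
    apply hinj
    change MvPolynomial.aeval P (MvPolynomial.aeval Q (P j)) =
      MvPolynomial.aeval P (MvPolynomial.X j)
    rw [MvPolynomial.aeval_X]
    exact DFunLike.congr_fun hPQ (P j)
  have hcomp : ∀ (R : Fin n → MvPolynomial (Fin n) k) (p : MvPolynomial (Fin n) k) (v : Fin n → k),
      MvPolynomial.eval (fun j => MvPolynomial.eval v (R j)) p =
        MvPolynomial.eval v (MvPolynomial.aeval R p) := by
    intro R p v
    have : (MvPolynomial.aeval v : MvPolynomial (Fin n) k →ₐ[k] k).comp (MvPolynomial.aeval R) =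
        MvPolynomial.aeval (fun j => MvPolynomial.eval v (R j)) := by
      ext i; simp [MvPolynomial.aeval_eq_eval]
    have := DFunLike.congr_fun this p
    simp only [AlgHom.comp_apply, MvPolynomial.aeval_eq_eval, RingHom.coe_coe] at this
    exact this.symm
  refine ⟨Q, fun u j => MvPolynomial.eval u (Q j), fun u => rfl, ?_, ?_⟩
  · intro v
    funext j
    simp only [hf]
    rw [hcomp, hQ, MvPolynomial.eval_X]
  · intro u
    rw [hf]
    funext j
    rw [hcomp, hQP, MvPolynomial.eval_X]
end
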